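/- Let f₁,…,f_ℓ ∈ ℝⁿ be orthonormal vectors and define F(i) = ((f₁)_i,…,(f_ℓ)_i)ᵀ ∈ ℝ^ℓ for each i ∈ [n]. Suppose ‖F(i)‖² ≤ ρ for all i. If s ≥ 100·ρ·n·log n and C ⊆ [n] is a uniformly random subset of size s, then with probability at least 1 - n^{-10}, (1/2)·I_ℓ ⪯ (n/s)·Σ_{i∈C} F(i)F(i)ᵀ ⪯ 2·I_ℓ. -/

import Mathlib

open Matrix

namespace Matrix
theorem isHermitian_sum {m α : Type*} {X : α → Matrix m m ℝ} (hX : ∀ i, (X i).IsHermitian) (C : Finset α) :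
    (∑ i ∈ C, X i).IsHermitian := by
  rw [IsHermitian, conjTranspose_sum]
  exact Finset.sum_congr rfl fun i _ => hX i

variable {m : Type*} [Fintype m]

theorem trace_mul_conjTranspose_self_nonneg (A : Matrix m m ℝ) : 0 ≤ (A * Aᴴ).trace :=
  (posSemidef_self_mul_conjTranspose A).trace_nonneg

theorem two_mul_trace_mul_le (A B : Matrix m m ℝ) :
    2 * (A * B).trace ≤ (A * Aᴴ).trace + (Bᴴ * B).trace := by
  have h := trace_mul_conjTranspose_self_nonneg (A - Bᴴ)
  have h2 : (Bᴴ * Aᴴ).trace = (A * B).trace := by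
    rw [← conjTranspose_mul, trace_conjTranspose, star_trivial]
  rw [conjTranspose_sub, conjTranspose_conjTranspose, sub_mul, mul_sub, mul_sub, trace_sub,
    trace_sub, trace_sub, h2] at h
  linarith

theorem IsHermitian.exists_dotProduct_mulVec_neg {A : Matrix m m ℝ} (hA : A.IsHermitian)
    (h : ¬ A.PosSemidef) : ∃ v, v ⬝ᵥ v = 1 ∧ v ⬝ᵥ A *ᵥ v < 0 := by
  obtain ⟨x, hx⟩ : ∃ x, x ⬝ᵥ A *ᵥ x < 0 := by
    by_contra! hcon
    exact h (PosSemidef.of_dotProduct_mulVec_nonneg hA (by simpa using hcon))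
  have hx0 : 0 < x ⬝ᵥ x := by
    refine lt_of_le_of_ne (Finset.sum_nonneg fun j _ => mul_self_nonneg (x j)) fun h0 => ?_
    rw [eq_comm, dotProduct_self_eq_zero] at h0
    simp [h0] at hx
  refine ⟨(√(x ⬝ᵥ x))⁻¹ • x, ?_, ?_⟩
  · rw [smul_dotProduct, dotProduct_smul, smul_eq_mul, smul_eq_mul, ← mul_assoc, ← mul_inv,
      Real.mul_self_sqrt hx0.le, inv_mul_cancel₀ hx0.ne']
  · rw [mulVec_smul, smul_dotProduct, dotProduct_smul, smul_eq_mul, smul_eq_mul, ← mul_assoc]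
    exact mul_neg_of_pos_of_neg (by positivity) hx

variable [DecidableEq m]

theorem IsHermitian.exists_diagonalization {A : Matrix m m ℝ} (hA : A.IsHermitian) :
    ∃ (U : Matrix m m ℝ) (d : m → ℝ), U * Uᴴ = 1 ∧ Uᴴ * U = 1 ∧ A = U * diagonal d * Uᴴ := by
  refine ⟨hA.eigenvectorUnitary, hA.eigenvalues, ?_, ?_, ?_⟩
  · exact Unitary.mul_star_self_of_mem hA.eigenvectorUnitary.2
  · exact Unitary.star_mul_self_of_mem hA.eigenvectorUnitary.2
  · conv_lhs => rw [hA.spectral_theorem, Unitary.conjStarAlgAut_apply]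
    rfl

theorem exp_orthogonal_conj_diagonal {U : Matrix m m ℝ} (hU : U * Uᴴ = 1) (d : m → ℝ) :
    NormedSpace.exp (U * diagonal d * Uᴴ) = U * diagonal (fun i => Real.exp (d i)) * Uᴴ := by
  have h : U⁻¹ = Uᴴ := inv_eq_right_inv hU
  rw [← h, exp_conj _ _ (IsUnit.of_mul_eq_one _ hU), exp_diagonal]
  congr 3
  ext i
  rw [Pi.coe_exp, Real.exp_eq_exp_ℝ]

/-- The tangent line bound `e ^ c * (1 + x - c) ≤ e ^ x`, lifted to symmetric matrices. -/
theorem IsHermitian.posSemidef_exp_sub_tangent {A : Matrix m m ℝ} (hA : A.IsHermitian) (c : ℝ) :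
    (NormedSpace.exp A - Real.exp c • ((1 - c) • (1 : Matrix m m ℝ) + A)).PosSemidef := by
  obtain ⟨U, d, hU, -, rfl⟩ := hA.exists_diagonalization
  have key : NormedSpace.exp (U * diagonal d * Uᴴ)
      - Real.exp c • ((1 - c) • (1 : Matrix m m ℝ) + U * diagonal d * Uᴴ)
      = U * diagonal (fun i => Real.exp (d i) - Real.exp c * (1 - c + d i)) * Uᴴ := by
    have h1 : (diagonal (fun i => Real.exp (d i) - Real.exp c * (1 - c + d i)) : Matrix m m ℝ)
        = diagonal (fun i => Real.exp (d i)) - Real.exp c • ((1 - c) • 1 + diagonal d) := by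
      ext i j
      by_cases hij : i = j <;> simp [hij, mul_add]
    rw [exp_orthogonal_conj_diagonal hU, h1]
    simp only [mul_sub, sub_mul, mul_add, add_mul, mul_smul_comm, smul_mul_assoc, mul_one, hU]
  rw [key]
  refine (PosSemidef.diagonal fun i => ?_).mul_mul_conjTranspose_same U
  have h2 : Real.exp (d i) = Real.exp c * Real.exp (d i - c) := by
    rw [← Real.exp_add]; ring_nf
  have h3 := Real.add_one_le_exp (d i - c)
  rw [Pi.zero_apply, h2, ← mul_sub]
  exact mul_nonneg (Real.exp_pos c).le (by linarith)

/-- The chord bound for `x ↦ e ^ (θ * x)` on `[0, r]`, lifted to symmetric matrices. -/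
theorem PosSemidef.posSemidef_chord_sub_exp {A : Matrix m m ℝ} (hA : A.PosSemidef) {r : ℝ}
    (hr : 0 < r) (hAr : (r • (1 : Matrix m m ℝ) - A).PosSemidef) (θ : ℝ) :
    (1 + ((Real.exp (θ * r) - 1) / r) • A - NormedSpace.exp (θ • A)).PosSemidef := by
  obtain ⟨U, d, hU, hU', rfl⟩ := hA.isHermitian.exists_diagonalization
  have hd0 : ∀ i, 0 ≤ d i := by
    have := hA.conjTranspose_mul_mul_same U
    rw [show Uᴴ * (U * diagonal d * Uᴴ) * U = (Uᴴ * U) * diagonal d * (Uᴴ * U) by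
      simp only [mul_assoc], hU'] at this
    simpa using this
  have hdr : ∀ i, 0 ≤ r - d i := by
    have := hAr.conjTranspose_mul_mul_same U
    rw [show Uᴴ * (r • 1 - U * diagonal d * Uᴴ) * U
        = r • (Uᴴ * U) - (Uᴴ * U) * diagonal d * (Uᴴ * U) by
      simp only [mul_assoc, mul_sub, sub_mul, mul_smul_comm, smul_mul_assoc, mul_one],
      hU', one_mul, mul_one] at this
    rw [← posSemidef_diagonal_iff]
    convert this using 1
    ext i j
    by_cases hij : i = j <;> simp [hij]
  have key : 1 + ((Real.exp (θ * r) - 1) / r) • (U * diagonal d * Uᴴ)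
      - NormedSpace.exp (θ • (U * diagonal d * Uᴴ))
      = U * diagonal (fun i => 1 + (Real.exp (θ * r) - 1) / r * d i - Real.exp (θ * d i)) * Uᴴ := by
    have h0 : θ • (U * diagonal d * Uᴴ) = U * diagonal (fun i => θ * d i) * Uᴴ := by
      rw [← smul_mul_assoc, ← mul_smul_comm, ← diagonal_smul]; rfl
    have h1 : (diagonal (fun i => 1 + (Real.exp (θ * r) - 1) / r * d i - Real.exp (θ * d i)) :
          Matrix m m ℝ)
        = 1 + ((Real.exp (θ * r) - 1) / r) • diagonal d - diagonal (fun i => Real.exp (θ * d i)) := by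
      ext i j
      by_cases hij : i = j <;> simp [hij]
    rw [h0, exp_orthogonal_conj_diagonal hU, h1]
    simp only [mul_sub, sub_mul, mul_add, add_mul, mul_smul_comm, smul_mul_assoc, mul_one, hU]
  rw [key]
  refine (PosSemidef.diagonal fun i => ?_).mul_mul_conjTranspose_same U
  have h0 : 0 ≤ d i := hd0 i
  have h1 : 0 ≤ r - d i := hdr i
  have hcx := convexOn_exp.2 (Set.mem_univ 0) (Set.mem_univ (θ * r))
    (div_nonneg h1 hr.le) (div_nonneg h0 hr.le) (by field_simp; ring)
  simp only [smul_eq_mul, mul_zero, zero_add, Real.exp_zero, mul_one] at hcx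
  rw [show d i / r * (θ * r) = θ * d i by field_simp] at hcx
  rw [Pi.zero_apply]
  have : (r - d i) / r + d i / r * Real.exp (θ * r) = 1 + (Real.exp (θ * r) - 1) / r * d i := by
    field_simp; ring
  linarith

theorem PosSemidef.trace_mul_nonneg {A B : Matrix m m ℝ} (hA : A.PosSemidef)
    (hB : B.PosSemidef) : 0 ≤ (A * B).trace := by
  obtain ⟨U, d, hU, hU', rfl⟩ := hA.isHermitian.exists_diagonalization
  have hd := hA.conjTranspose_mul_mul_same U
  rw [show Uᴴ * (U * diagonal d * Uᴴ) * U = (Uᴴ * U) * diagonal d * (Uᴴ * U) by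
    simp only [mul_assoc], hU', one_mul, mul_one, posSemidef_diagonal_iff] at hd
  rw [mul_assoc, mul_assoc, trace_mul_comm, mul_assoc, trace]
  refine Finset.sum_nonneg fun i _ => ?_
  rw [diag_apply, diagonal_mul]
  exact mul_nonneg (hd i) (hB.conjTranspose_mul_mul_same U).diag_nonneg

theorem IsHermitian.posSemidef_exp {A : Matrix m m ℝ} (hA : A.IsHermitian) :
    (NormedSpace.exp A).PosSemidef := by
  obtain ⟨U, d, hU, -, rfl⟩ := hA.exists_diagonalization
  rw [exp_orthogonal_conj_diagonal hU]
  exact (PosSemidef.diagonal fun i => (Real.exp_pos _).le).mul_mul_conjTranspose_same U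


theorem PosSemidef.dotProduct_mulVec_le_trace {A : Matrix m m ℝ} (hA : A.PosSemidef)
    {v : m → ℝ} (hv : v ⬝ᵥ v = 1) : v ⬝ᵥ A *ᵥ v ≤ A.trace := by
  have hP : (1 - vecMulVec v v : Matrix m m ℝ).PosSemidef := by
    have := posSemidef_conjTranspose_mul_self (1 - vecMulVec v v : Matrix m m ℝ)
    have h1 : (vecMulVec v v)ᴴ = vecMulVec v v := by
      ext i j; simp [vecMulVec_apply, mul_comm]
    have h2 : vecMulVec v v * vecMulVec v v = vecMulVec v v := by
      rw [vecMulVec_mul_vecMulVec, hv, one_smul]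
    rwa [conjTranspose_sub, conjTranspose_one, h1, sub_mul, mul_sub, mul_sub, h2, one_mul, one_mul,
      mul_one, sub_self, sub_zero] at this
  have := hA.trace_mul_nonneg hP
  rw [mul_sub, mul_one, trace_sub, mul_vecMulVec, trace_vecMulVec, dotProduct_comm] at this
  linarith

/-- **Peierls' inequality** for a single unit vector. -/
theorem IsHermitian.exp_dotProduct_mulVec_le {A : Matrix m m ℝ} (hA : A.IsHermitian)
    {v : m → ℝ} (hv : v ⬝ᵥ v = 1) :
    Real.exp (v ⬝ᵥ A *ᵥ v) ≤ v ⬝ᵥ NormedSpace.exp A *ᵥ v := by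
  have := (hA.posSemidef_exp_sub_tangent (v ⬝ᵥ A *ᵥ v)).dotProduct_mulVec_nonneg v
  simp only [star_trivial, sub_mulVec, smul_mulVec, add_mulVec, one_mulVec, dotProduct_sub,
    dotProduct_smul, dotProduct_add, hv, smul_eq_mul] at this
  linarith

/-- Jensen's inequality for the convex function `A ↦ tr (exp A)` on symmetric matrices. -/
theorem trace_exp_average_le {ι : Type*} [Fintype ι] [Nonempty ι] (A : ι → Matrix m m ℝ)
    (hA : ∀ t, (A t).IsHermitian) :
    (NormedSpace.exp ((Fintype.card ι : ℝ)⁻¹ • ∑ t, A t)).trace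
      ≤ (Fintype.card ι : ℝ)⁻¹ * ∑ t, (NormedSpace.exp (A t)).trace := by
  set c : ℝ := (Fintype.card ι : ℝ)⁻¹ with hc
  have hc0 : 0 ≤ c := by positivity
  have hB : (c • ∑ t, A t).IsHermitian := by
    unfold IsHermitian
    rw [conjTranspose_smul, conjTranspose_sum, star_trivial]
    simp only [fun t => (hA t).eq]
  obtain ⟨U, d, hU, hU', hd⟩ := hB.exists_diagonalization
  have htr : ∀ M : Matrix m m ℝ, M.trace = ∑ i, (Uᴴ * M * U) i i := fun M => by
    rw [show ∑ i, (Uᴴ * M * U) i i = (Uᴴ * M * U).trace from rfl, trace_mul_comm, ← mul_assoc, hU,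
      one_mul]
  have hquad : ∀ (M : Matrix m m ℝ) i, (Uᴴ * M * U) i i = U.col i ⬝ᵥ M *ᵥ U.col i := fun M i => by
    rw [mul_assoc, mul_apply]
    rfl
  have hunit : ∀ i, U.col i ⬝ᵥ U.col i = 1 := fun i => by
    have := hquad 1 i
    rw [mul_one, hU', one_mulVec, one_apply_eq] at this
    exact this.symm
  rw [hd, exp_orthogonal_conj_diagonal hU]
  have hdi : ∀ i, d i = ∑ t, c * (U.col i ⬝ᵥ A t *ᵥ U.col i) := fun i => by
    have : (Uᴴ * (U * diagonal d * Uᴴ) * U) i i = d i := by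
      rw [show Uᴴ * (U * diagonal d * Uᴴ) * U = (Uᴴ * U) * diagonal d * (Uᴴ * U) by
        simp only [mul_assoc], hU', one_mul, mul_one, diagonal_apply_eq]
    rw [← this, ← hd, hquad, smul_mulVec, sum_mulVec, dotProduct_smul, dotProduct_sum, smul_eq_mul,
      Finset.mul_sum]
  have hjensen : ∀ i, Real.exp (d i) ≤ ∑ t, c * (Uᴴ * NormedSpace.exp (A t) * U) i i := fun i => by
    rw [hdi]
    refine (convexOn_exp.map_sum_le (t := Finset.univ) (w := fun _ => c) (fun _ _ => hc0)
      (by simp [hc]) (fun _ _ => Set.mem_univ _)).trans ?_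
    refine Finset.sum_le_sum fun t _ => ?_
    rw [hquad, smul_eq_mul]
    exact mul_le_mul_of_nonneg_left ((hA t).exp_dotProduct_mulVec_le (hunit i)) hc0
  rw [trace_mul_comm, ← mul_assoc, hU', one_mul, trace_diagonal]
  refine (Finset.sum_le_sum fun i _ => hjensen i).trans_eq ?_
  rw [Finset.sum_comm, Finset.mul_sum]
  simp only [htr, Finset.mul_sum]

theorem trace_mul_pow_comm (X Y : Matrix m m ℝ) (j : ℕ) :
    ((X * Y) ^ j).trace = ((Y * X) ^ j).trace := by
  cases j with
  | zero => simp
  | succ j => rw [pow_succ, ← mul_assoc, mul_pow_mul, trace_mul_comm, ← mul_assoc, pow_succ']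

/-- Weyl-type and Lieb–Thirring-type trace inequalities for exponents that are powers of two. -/
theorem trace_pow_two_pow_le_and_trace_mul_pow_two_pow_le (k : ℕ) :
    (∀ Z : Matrix m m ℝ, (Z ^ 2 ^ (k + 1)).trace ≤ ((Z * Zᴴ) ^ 2 ^ k).trace) ∧
    (∀ P Q : Matrix m m ℝ, P.IsHermitian → Q.IsHermitian →
      ((P * Q) ^ 2 ^ k).trace ≤ (P ^ 2 ^ k * Q ^ 2 ^ k).trace) := by
  induction k with
  | zero =>
    refine ⟨fun Z => ?_, fun P Q _ _ => by simp⟩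
    have := two_mul_trace_mul_le Z Z
    rw [trace_mul_comm Zᴴ Z] at this
    simp only [zero_add, pow_one, pow_zero, pow_two]
    linarith
  | succ k ih =>
    obtain ⟨ihW, ihG⟩ := ih
    constructor
    · intro Z
      have hP : (Zᴴ * Z).IsHermitian := isHermitian_conjTranspose_mul_self Z
      have hQ : (Z * Zᴴ).IsHermitian := isHermitian_mul_conjTranspose_self Z
      have h1 := ihW (Z ^ 2)
      rw [← pow_mul, ← pow_succ'] at h1
      have h2 : ((Z ^ 2 * (Z ^ 2)ᴴ) ^ 2 ^ k).trace = ((Zᴴ * Z * (Z * Zᴴ)) ^ 2 ^ k).trace := by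
        rw [show Z ^ 2 * (Z ^ 2)ᴴ = (Z * (Z * Zᴴ)) * Zᴴ by
          simp only [pow_two, conjTranspose_mul, mul_assoc], trace_mul_pow_comm]
        simp only [mul_assoc]
      have h3 := ihG _ _ hP hQ
      have h4 := two_mul_trace_mul_le ((Zᴴ * Z) ^ 2 ^ k) ((Z * Zᴴ) ^ 2 ^ k)
      rw [(hP.pow _).eq, (hQ.pow _).eq, ← pow_add, ← pow_add, trace_mul_pow_comm Zᴴ Z,
        ← two_mul (2 ^ k), ← pow_succ'] at h4
      rw [h2] at h1
      linarith
    · intro P Q hP hQ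
      have h1 := ihW (P * Q)
      have h2 := ihG (P ^ 2) (Q ^ 2) (hP.pow 2) (hQ.pow 2)
      have h3 : ((P * Q * (P * Q)ᴴ) ^ 2 ^ k).trace = ((P ^ 2 * Q ^ 2) ^ 2 ^ k).trace := by
        rw [conjTranspose_mul, hP.eq, hQ.eq, show P * Q * (Q * P) = (P * Q ^ 2) * P by
          simp only [pow_two, mul_assoc], trace_mul_pow_comm]
        simp only [pow_two, mul_assoc]
      rw [← pow_mul, ← pow_mul, ← pow_succ'] at h2
      linarith

end Matrix

theorem NormedSpace.norm_exp_le {𝔸 : Type*} [NormedRing 𝔸] [NormedAlgebra ℝ 𝔸] [CompleteSpace 𝔸]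
    [NormOneClass 𝔸] (x : 𝔸) : ‖NormedSpace.exp x‖ ≤ Real.exp ‖x‖ := by
  rw [Real.exp_eq_exp_ℝ, NormedSpace.exp_eq_tsum ℝ, NormedSpace.exp_eq_tsum ℝ]
  refine tsum_of_norm_bounded (NormedSpace.expSeries_summable' ‖x‖).hasSum fun n => ?_
  rw [norm_smul, smul_eq_mul, Real.norm_of_nonneg (by positivity)]
  gcongr
  exact norm_pow_le x n

theorem norm_pow_sub_pow_le {𝔸 : Type*} [NormedRing 𝔸] [NormOneClass 𝔸] {x y : 𝔸} {K : ℝ}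
    (hK : 1 ≤ K) (hx : ‖x‖ ≤ K) (hy : ‖y‖ ≤ K) (N : ℕ) :
    ‖x ^ N - y ^ N‖ ≤ K ^ N * (N * ‖x - y‖) := by
  induction N with
  | zero => simp
  | succ N ih =>
    have h1 : x ^ (N + 1) - y ^ (N + 1) = x * (x ^ N - y ^ N) + (x - y) * y ^ N := by
      rw [pow_succ', pow_succ', mul_sub, sub_mul]; abel
    have h2 : ‖x * (x ^ N - y ^ N)‖ ≤ K * (K ^ N * (N * ‖x - y‖)) :=
      (norm_mul_le _ _).trans (by gcongr)
    have h3 : ‖(x - y) * y ^ N‖ ≤ ‖x - y‖ * K ^ N :=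
      (norm_mul_le _ _).trans (by gcongr; exact (norm_pow_le y N).trans (by gcongr))
    have h4 : ‖x - y‖ * K ^ N ≤ ‖x - y‖ * K ^ (N + 1) := by gcongr; omega
    rw [h1]
    refine (norm_add_le _ _).trans ((add_le_add h2 (h3.trans h4)).trans_eq ?_)
    push_cast
    ring

open Filter Topology in
/-- The **Lie–Trotter product formula** in a Banach algebra. -/
theorem NormedSpace.tendsto_exp_smul_mul_exp_smul_pow {𝔸 : Type*} [NormedRing 𝔸]
    [NormedAlgebra ℝ 𝔸] [CompleteSpace 𝔸] [NormOneClass 𝔸] (a b : 𝔸) :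
    Tendsto (fun N : ℕ => (NormedSpace.exp ((N : ℝ)⁻¹ • a) * NormedSpace.exp ((N : ℝ)⁻¹ • b)) ^ N)
      atTop (𝓝 (NormedSpace.exp (a + b))) := by
  let _ : NormedAlgebra ℚ 𝔸 := NormedAlgebra.restrictScalars ℚ ℝ 𝔸
  set g : ℝ → 𝔸 := fun t => NormedSpace.exp (t • a) * NormedSpace.exp (t • b)
    - NormedSpace.exp (t • (a + b)) with hg
  have hderiv : HasDerivAt g 0 0 := by
    have := ((hasDerivAt_exp_smul_const (𝕂 := ℝ) a (0 : ℝ)).mul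
      (hasDerivAt_exp_smul_const (𝕂 := ℝ) b (0 : ℝ))).sub
      (hasDerivAt_exp_smul_const (𝕂 := ℝ) (a + b) (0 : ℝ))
    simpa [hg] using! this
  have hinv : Tendsto (fun N : ℕ => (N : ℝ)⁻¹) atTop (𝓝[≠] 0) := by
    refine tendsto_nhdsWithin_iff.mpr ⟨tendsto_inv_atTop_nhds_zero_nat, ?_⟩
    filter_upwards [eventually_gt_atTop 0] with N hN
    simp [hN.ne']
  have hlim : Tendsto (fun N : ℕ => Real.exp (‖a‖ + ‖b‖) * ((N : ℝ) * ‖g (N : ℝ)⁻¹‖)) atTop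
      (𝓝 0) := by
    have h1 := ((hderiv.tendsto_slope_zero.comp hinv).norm).const_mul (Real.exp (‖a‖ + ‖b‖))
    rw [norm_zero, mul_zero] at h1
    refine h1.congr fun N => ?_
    simp [hg, norm_smul]
  rw [tendsto_iff_norm_sub_tendsto_zero]
  refine squeeze_zero' (Eventually.of_forall fun _ => norm_nonneg _) ?_ hlim
  filter_upwards [eventually_gt_atTop 0] with N hN
  have hN0 : (N : ℝ) ≠ 0 := by positivity
  have hpow : NormedSpace.exp (a + b) = NormedSpace.exp ((N : ℝ)⁻¹ • (a + b)) ^ N := by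
    rw [← NormedSpace.exp_nsmul, ← Nat.cast_smul_eq_nsmul ℝ, smul_smul, mul_inv_cancel₀ hN0,
      one_smul]
  have hK : Real.exp (‖a‖ + ‖b‖) = Real.exp ((N : ℝ)⁻¹ * (‖a‖ + ‖b‖)) ^ N := by
    rw [← Real.exp_nat_mul, mul_inv_cancel_left₀ hN0]
  have hnorm : ∀ x : 𝔸, ‖(N : ℝ)⁻¹ • x‖ = (N : ℝ)⁻¹ * ‖x‖ := fun x => by
    rw [norm_smul, Real.norm_of_nonneg (by positivity)]
  rw [hpow, hK]
  refine norm_pow_sub_pow_le (Real.one_le_exp (by positivity)) ?_ ?_ N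
  · refine (norm_mul_le _ _).trans ?_
    rw [mul_add, Real.exp_add]
    gcongr
    · exact (NormedSpace.norm_exp_le _).trans_eq (by rw [hnorm])
    · exact (NormedSpace.norm_exp_le _).trans_eq (by rw [hnorm])
  · refine (NormedSpace.norm_exp_le _).trans ?_
    rw [hnorm]
    gcongr
    exact norm_add_le a b

namespace Matrix
variable {m : Type*} [Fintype m] [DecidableEq m]

open Filter Topology in
/-- The **Golden–Thompson inequality** for real symmetric matrices. -/
theorem IsHermitian.trace_exp_add_le {A B : Matrix m m ℝ} (hA : A.IsHermitian)
    (hB : B.IsHermitian) :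
    (NormedSpace.exp (A + B)).trace ≤ (NormedSpace.exp A * NormedSpace.exp B).trace := by
  cases isEmpty_or_nonempty m
  · simp [trace]
  let _ : NormedRing (Matrix m m ℝ) := Matrix.linftyOpNormedRing
  let _ : NormedAlgebra ℝ (Matrix m m ℝ) := Matrix.linftyOpNormedAlgebra
  let _ : NormOneClass (Matrix m m ℝ) := Matrix.linfty_opNormOneClass
  have hlim := ((continuous_id.matrix_trace (n := m) (R := ℝ)).tendsto _).comp
    ((NormedSpace.tendsto_exp_smul_mul_exp_smul_pow A B).comp
      (tendsto_pow_atTop_atTop_of_one_lt one_lt_two))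
  refine le_of_tendsto hlim (Eventually.of_forall fun k => ?_)
  have hc : ((2 ^ k : ℕ) : ℝ) ≠ 0 := by positivity
  have hexp : ∀ M : Matrix m m ℝ, NormedSpace.exp (((2 ^ k : ℕ) : ℝ)⁻¹ • M) ^ 2 ^ k
      = NormedSpace.exp M := fun M => by
    rw [← exp_nsmul, ← Nat.cast_smul_eq_nsmul ℝ, smul_smul, mul_inv_cancel₀ hc, one_smul]
  have hherm : ∀ M : Matrix m m ℝ, M.IsHermitian →
      (NormedSpace.exp (((2 ^ k : ℕ) : ℝ)⁻¹ • M)).IsHermitian := fun M hM => by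
    refine IsHermitian.exp ?_
    rw [IsHermitian, conjTranspose_smul, hM.eq, star_trivial]
  have := (trace_pow_two_pow_le_and_trace_mul_pow_two_pow_le k).2 _ _ (hherm A hA) (hherm B hB)
  rwa [hexp, hexp] at this

end Matrix

namespace Matrix
variable {m : Type*} [Fintype m] [DecidableEq m] {α : Type*} [Fintype α]

/-- Iterated Golden–Thompson: the trace-exponential moment of a sum of `s` independent uniform
draws (with replacement) from the family `X`, in unnormalized form. -/
theorem sum_trace_exp_sum_le {X : α → Matrix m m ℝ} (hX : ∀ i, (X i).IsHermitian) {M : ℝ}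
    (hM0 : 0 ≤ M) (hM : (M • (1 : Matrix m m ℝ) - ∑ i, NormedSpace.exp (X i)).PosSemidef) (s : ℕ) :
    ∑ y : Fin s → α, (NormedSpace.exp (∑ k, X (y k))).trace ≤ M ^ s * Fintype.card m := by
  induction s with
  | zero => simp
  | succ s ih =>
    rw [← (Fin.consEquiv fun _ : Fin (s + 1) => α).sum_comp, Fintype.sum_prod_type_right]
    have hstep : ∀ y : Fin s → α,
        ∑ i, (NormedSpace.exp (∑ k, X (Fin.consEquiv (fun _ : Fin (s + 1) => α) (i, y) k))).trace
          ≤ M * (NormedSpace.exp (∑ k, X (y k))).trace := fun y => by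
      have hS : (∑ k, X (y k)).IsHermitian := isHermitian_sum (fun k => hX (y k)) _
      have h1 : ∀ i, (NormedSpace.exp
          (∑ k, X (Fin.consEquiv (fun _ : Fin (s + 1) => α) (i, y) k))).trace
          ≤ (NormedSpace.exp (X i) * NormedSpace.exp (∑ k, X (y k))).trace := fun i => by
        rw [Fin.sum_univ_succ]
        exact (hX i).trace_exp_add_le hS
      refine (Finset.sum_le_sum fun i _ => h1 i).trans ?_
      have h2 := hM.trace_mul_nonneg hS.posSemidef_exp
      rw [sub_mul, trace_sub, smul_mul_assoc, one_mul, trace_smul, smul_eq_mul, Finset.sum_mul,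
        trace_sum] at h2
      linarith
    refine (Finset.sum_le_sum fun y _ => hstep y).trans ?_
    rw [← Finset.mul_sum, pow_succ', mul_assoc]
    exact mul_le_mul_of_nonneg_left ih hM0

open Equiv in
/-- Hoeffding's comparison: for a randomly relabelled family of symmetric matrices, the trace
exponential of the sum over distinct labels is dominated by that over arbitrary labels. -/
theorem sum_perm_trace_exp_le [DecidableEq α] {X : α → Matrix m m ℝ}
    (hX : ∀ i, (X i).IsHermitian) {s : ℕ} (hs : 0 < s) (e : Fin s ↪ α) (y : Fin s → α) :
    ∑ σ : Perm α, (NormedSpace.exp (∑ k, X (σ (e k)))).trace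
      ≤ ∑ σ : Perm α, (NormedSpace.exp (∑ k, X (σ (y k)))).trace := by
  have : NeZero s := ⟨hs.ne'⟩
  have hs0 : (s : ℝ) ≠ 0 := by positivity
  obtain ⟨C, hyC, hC⟩ : ∃ C : Finset α, Finset.univ.image y ⊆ C ∧ C.card = s := by
    refine Finset.exists_superset_card_eq (Finset.card_image_le.trans (by simp)) ?_
    simpa using Fintype.card_le_of_embedding e
  let e' : Fin s ↪ α := (C.equivFinOfCardEq hC).symm.toEmbedding.trans (Function.Embedding.subtype _)
  obtain ⟨g, hg⟩ : ∃ g : Fin s → Fin s, ∀ k, y k = e' (g k) :=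
    ⟨fun k => C.equivFinOfCardEq hC ⟨y k, hyC (Finset.mem_image_of_mem y (Finset.mem_univ k))⟩,
      fun k => by simp [e']⟩
  obtain ⟨π, hπ⟩ := (Perm.isMultiplyPretransitive α s).exists_smul_eq e e'
  have hπ' : ∀ k, π (e k) = e' k := fun k => DFunLike.congr_fun hπ k
  have hshift : ∀ t : Fin s, ∑ σ : Perm α, (NormedSpace.exp (∑ k, X (σ (y k)))).trace
      = ∑ σ : Perm α, (NormedSpace.exp (∑ k, X (σ (e (g k + t))))).trace := fun t => by
    rw [← Equiv.sum_comp (Equiv.mulRight ((Equiv.addRight t : Perm (Fin s)).viaEmbedding e * π⁻¹))]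
    refine Finset.sum_congr rfl fun σ _ => ?_
    congr 3
    ext1 k
    rw [Equiv.coe_mulRight, Perm.mul_apply, Perm.mul_apply, hg, ← hπ',
      Equiv.Perm.inv_def, Equiv.symm_apply_apply, Perm.viaEmbedding_apply, Equiv.coe_addRight]
  have havg : ∑ σ : Perm α, (NormedSpace.exp (∑ k, X (σ (y k)))).trace
      = ∑ σ : Perm α, (Fintype.card (Fin s) : ℝ)⁻¹
          * ∑ t, (NormedSpace.exp (∑ k, X (σ (e (g k + t))))).trace := by
    rw [← Finset.mul_sum, Finset.sum_comm, ← Finset.sum_congr rfl fun t _ => hshift t,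
      Finset.sum_const, Finset.card_univ, nsmul_eq_mul, Fintype.card_fin, inv_mul_cancel_left₀ hs0]
  rw [havg]
  refine Finset.sum_le_sum fun σ _ => ?_
  refine le_of_eq_of_le ?_ (trace_exp_average_le (fun t => ∑ k, X (σ (e (g k + t))))
    fun t => isHermitian_sum (fun k => hX _) _)
  have hsum : ∀ k, ∑ t, X (σ (e (g k + t))) = ∑ j, X (σ (e j)) := fun k =>
    Equiv.sum_comp (Equiv.addLeft (g k)) fun j => X (σ (e j))
  rw [Finset.sum_comm, Finset.sum_congr rfl fun k _ => hsum k, Finset.sum_const, Finset.card_univ,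
    Fintype.card_fin, ← Nat.cast_smul_eq_nsmul ℝ, smul_smul, inv_mul_cancel₀ hs0, one_smul]

open Equiv in
/-- The trace-exponential moment of sampling without replacement is at most that of sampling with
replacement. -/
theorem card_pow_mul_sum_powersetCard_trace_exp_le [DecidableEq α] {X : α → Matrix m m ℝ}
    (hX : ∀ i, (X i).IsHermitian) {s : ℕ} (hs : 0 < s) :
    (Fintype.card α : ℝ) ^ s *
        ∑ C ∈ Finset.univ.powersetCard s, (NormedSpace.exp (∑ i ∈ C, X i)).trace
      ≤ ((Finset.univ : Finset α).powersetCard s).card *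
        ∑ y : Fin s → α, (NormedSpace.exp (∑ k, X (y k))).trace := by
  have hperm : (0 : ℝ) < Fintype.card (Perm α) := by
    exact_mod_cast Fintype.card_pos
  have hsets : ∀ σ : Perm α,
      ∑ C ∈ Finset.univ.powersetCard s, (NormedSpace.exp (∑ i ∈ C, X (σ i))).trace
        = ∑ C ∈ Finset.univ.powersetCard s, (NormedSpace.exp (∑ i ∈ C, X i)).trace := fun σ => by
    refine Finset.sum_equiv σ.finsetCongr (fun C => by simp) fun C _ => ?_
    simp
  have hseqs : ∀ σ : Perm α, ∑ y : Fin s → α, (NormedSpace.exp (∑ k, X (σ (y k)))).trace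
        = ∑ y : Fin s → α, (NormedSpace.exp (∑ k, X (y k))).trace := fun σ =>
    (Equiv.arrowCongr (Equiv.refl (Fin s)) σ).sum_comp
      fun y => (NormedSpace.exp (∑ k, X (y k))).trace
  have hmain : ∀ C ∈ (Finset.univ : Finset α).powersetCard s, ∀ y : Fin s → α,
      ∑ σ : Perm α, (NormedSpace.exp (∑ i ∈ C, X (σ i))).trace
        ≤ ∑ σ : Perm α, (NormedSpace.exp (∑ k, X (σ (y k)))).trace := fun C hC y => by
    rw [Finset.mem_powersetCard] at hC
    let E := C.equivFinOfCardEq hC.2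
    refine le_of_eq_of_le (Finset.sum_congr rfl fun σ _ => ?_) (sum_perm_trace_exp_le hX hs
      (E.symm.toEmbedding.trans (Function.Embedding.subtype _)) y)
    rw [← Finset.sum_coe_sort C, ← E.symm.sum_comp]
    rfl
  have htotal := Finset.sum_le_sum fun C hC =>
    Finset.sum_le_sum fun y (_ : y ∈ (Finset.univ : Finset (Fin s → α))) => hmain C hC y
  simp only [Finset.sum_const, Finset.card_univ, Fintype.card_fun, Fintype.card_fin, nsmul_eq_mul,
    ← Finset.mul_sum] at htotal
  rw [Finset.sum_comm, Finset.sum_congr rfl fun σ _ => hsets σ,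
    Finset.sum_comm (s := (Finset.univ : Finset (Fin s → α))),
    Finset.sum_congr rfl fun σ _ => hseqs σ] at htotal
  simp only [Finset.sum_const, Finset.card_univ, nsmul_eq_mul, Nat.cast_pow] at htotal
  refine le_of_mul_le_mul_left ?_ hperm
  linarith

/-- Exponential moment bound for a uniformly random subset of an isotropic family of vectors. -/
theorem sum_powersetCard_trace_exp_vecMulVec_le [DecidableEq α] [Nonempty α] {F : α → m → ℝ}
    (hF : ∑ i, vecMulVec (F i) (F i) = 1) {ρ : ℝ} (hρ0 : 0 < ρ) (hρ : ∀ i, F i ⬝ᵥ F i ≤ ρ)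
    {s : ℕ} (hs : 0 < s) (θ : ℝ) :
    ∑ C ∈ (Finset.univ : Finset α).powersetCard s,
        (NormedSpace.exp (θ • ∑ i ∈ C, vecMulVec (F i) (F i))).trace
      ≤ ((Finset.univ : Finset α).powersetCard s).card *
        (Fintype.card m * Real.exp (s * ((Real.exp (θ * ρ) - 1) / (Fintype.card α * ρ)))) := by
  set n : ℝ := (Fintype.card α : ℝ) with hn
  have hn0 : 0 < n := by rw [hn]; exact_mod_cast Fintype.card_pos
  set c : ℝ := (Real.exp (θ * ρ) - 1) / ρ with hc
  have hcn : (Real.exp (θ * ρ) - 1) / (n * ρ) = c / n := by rw [hc]; field_simp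
  rw [hcn]
  have hpsd : ∀ i, (vecMulVec (F i) (F i)).PosSemidef := fun i => by
    simpa using posSemidef_vecMulVec_self_star (F i)
  have hX : ∀ i, (θ • vecMulVec (F i) (F i)).IsHermitian := fun i => by
    rw [IsHermitian, conjTranspose_smul, (hpsd i).isHermitian.eq, star_trivial]
  have hle : ∀ i, (ρ • (1 : Matrix m m ℝ) - vecMulVec (F i) (F i)).PosSemidef := fun i => by
    refine PosSemidef.of_dotProduct_mulVec_nonneg ?_ fun x => ?_
    · rw [IsHermitian, conjTranspose_sub, (hpsd i).isHermitian.eq, conjTranspose_smul,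
        conjTranspose_one, star_trivial]
    · have hcs : (F i ⬝ᵥ x) ^ 2 ≤ (F i ⬝ᵥ F i) * (x ⬝ᵥ x) := by
        simpa [dotProduct, pow_two] using Finset.sum_mul_sq_le_sq_mul_sq Finset.univ (F i) x
      have hxx : 0 ≤ x ⬝ᵥ x := Finset.sum_nonneg fun j _ => mul_self_nonneg (x j)
      have := mul_le_mul_of_nonneg_right (hρ i) hxx
      rw [star_trivial, sub_mulVec, smul_mulVec, one_mulVec, dotProduct_sub, dotProduct_smul,
        vecMulVec_mulVec, dotProduct_comm x (_ • _)]
      simp only [op_smul_eq_smul, smul_dotProduct, smul_eq_mul]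
      nlinarith
  have hM : ((n * Real.exp (c / n)) • (1 : Matrix m m ℝ)
      - ∑ i, NormedSpace.exp (θ • vecMulVec (F i) (F i))).PosSemidef := by
    have h1 := posSemidef_sum Finset.univ fun i _ =>
      (hpsd i).posSemidef_chord_sub_exp hρ0 (hle i) θ
    rw [Finset.sum_sub_distrib, Finset.sum_add_distrib, ← Finset.smul_sum, hF, Finset.sum_const,
      Finset.card_univ, ← Nat.cast_smul_eq_nsmul ℝ, ← hn, ← hc] at h1
    have h2 : 0 ≤ n * Real.exp (c / n) - (n + c) := by
      have := mul_le_mul_of_nonneg_left (Real.add_one_le_exp (c / n)) hn0.le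
      rw [mul_add, mul_div_cancel₀ _ hn0.ne'] at this
      linarith
    convert h1.add ((PosSemidef.one (n := m) (R := ℝ)).smul h2) using 1
    module
  have hiid := sum_trace_exp_sum_le hX (by positivity) hM s
  have hcomp := card_pow_mul_sum_powersetCard_trace_exp_le hX hs
  simp only [← Finset.smul_sum, ← hn] at hiid hcomp
  have := hcomp.trans (mul_le_mul_of_nonneg_left hiid (Nat.cast_nonneg _))
  refine le_of_mul_le_mul_left (this.trans_eq ?_) (pow_pos hn0 s)
  rw [mul_pow, ← Real.exp_nat_mul]
  ring

/-- Chernoff tail bound, obtained from the exponential moment by Markov's inequality. -/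
theorem card_filter_mul_exp_le [DecidableEq α] [Nonempty α] {F : α → m → ℝ}
    (hF : ∑ i, vecMulVec (F i) (F i) = 1) {ρ : ℝ} (hρ0 : 0 < ρ) (hρ : ∀ i, F i ⬝ᵥ F i ≤ ρ)
    {s : ℕ} (hs : 0 < s) (θ b : ℝ) (p : Finset α → Prop) [DecidablePred p]
    (hp : ∀ C, p C → ∃ v, v ⬝ᵥ v = 1 ∧
      b ≤ θ * (v ⬝ᵥ (∑ i ∈ C, vecMulVec (F i) (F i)) *ᵥ v)) :
    ((((Finset.univ : Finset α).powersetCard s).filter p).card : ℝ) * Real.exp b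
      ≤ ((Finset.univ : Finset α).powersetCard s).card *
        (Fintype.card m * Real.exp (s * ((Real.exp (θ * ρ) - 1) / (Fintype.card α * ρ)))) := by
  refine le_trans ?_ (sum_powersetCard_trace_exp_vecMulVec_le hF hρ0 hρ hs θ)
  have hherm : ∀ C : Finset α, (θ • ∑ i ∈ C, vecMulVec (F i) (F i)).IsHermitian := fun C => by
    rw [IsHermitian, conjTranspose_smul, star_trivial, (isHermitian_sum (fun i => ?_) C).eq]
    simpa using (posSemidef_vecMulVec_self_star (F i)).isHermitian
  rw [← nsmul_eq_mul, ← Finset.sum_const]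
  refine (Finset.sum_le_sum fun C hC => ?_).trans (Finset.sum_le_sum_of_subset_of_nonneg
    (Finset.filter_subset p _) fun C _ _ => (hherm C).posSemidef_exp.trace_nonneg)
  obtain ⟨v, hv, hb⟩ := hp C (Finset.mem_filter.mp hC).2
  refine (Real.exp_le_exp.mpr ?_).trans (((hherm C).exp_dotProduct_mulVec_le hv).trans
    ((hherm C).posSemidef_exp.dotProduct_mulVec_le_trace hv))
  rwa [smul_mulVec, dotProduct_smul, smul_eq_mul]

end Matrix

theorem Finset.card_le_card_filter_and_add_card_filter_not {β : Type*} (T : Finset β)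
    (p q : β → Prop) [DecidablePred p] [DecidablePred q] :
    T.card ≤ (T.filter fun C => p C ∧ q C).card +
      (T.filter fun C => ¬ p C).card + (T.filter fun C => ¬ q C).card := by
  classical
  refine (Finset.card_le_card fun C hC => ?_).trans ((Finset.card_union_le
    ((T.filter fun C => p C ∧ q C) ∪ T.filter fun C => ¬ p C) (T.filter fun C => ¬ q C)).trans
    (Nat.add_le_add_right (Finset.card_union_le _ _) _))
  simp only [Finset.mem_union, Finset.mem_filter]
  tauto

theorem exp_mul_le_pow_neg_twelve {n : ℕ} (hn : 0 < n) {x a : ℝ} (ha : a ≤ -(12 / 100))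
    (hx : 100 * Real.log n ≤ x) : Real.exp (x * a) ≤ (n : ℝ) ^ (-(12 : ℤ)) := by
  have hlog : 0 ≤ Real.log n := Real.log_natCast_nonneg n
  have : (n : ℝ) ^ (-(12 : ℤ)) = Real.exp (Real.log n * (-12)) := by
    rw [← Real.rpow_def_of_pos (by positivity), ← Real.rpow_intCast]
    norm_num
  rw [this, Real.exp_le_exp]
  nlinarith

/-- Matrix-Chernoff statement: if `f₁,…,f_ℓ` are orthonormal with rows `F(i)` of squared
norm at most `ρ`, and `s ≥ 100 ρ n log n`, then for a uniformly random size-`s` subset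
`C ⊆ [n]` (formalized by counting subsets), with probability at least `1 - n⁻¹⁰` we have
`(1/2)·I ⪯ (n/s)·Σ_{i∈C} F(i)F(i)ᵀ ⪯ 2·I`. -/
theorem stmt16 {n ℓ : ℕ} (f : Fin ℓ → (Fin n → ℝ))
    (horth : ∀ a a', f a ⬝ᵥ f a' = if a = a' then 1 else 0)
    (F : Fin n → (Fin ℓ → ℝ)) (hF : F = fun i j => f j i)
    (ρ : ℝ) (hρ : ∀ i, ∑ j, (F i j) ^ 2 ≤ ρ)
    (s : ℕ) (hs : s ≤ n) (hs0 : 0 < s)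
    (hslb : 100 * ρ * n * Real.log n ≤ s) :
    (1 - (n : ℝ) ^ (-(10 : ℤ))) *
        (((Finset.univ : Finset (Fin n)).powersetCard s).card : ℝ) ≤
      ((@Finset.filter (Finset (Fin n))
          (fun Cs =>
            (((n : ℝ) / s) • (∑ i ∈ Cs, vecMulVec (F i) (F i)) -
              (1 / 2 : ℝ) • (1 : Matrix (Fin ℓ) (Fin ℓ) ℝ)).PosSemidef ∧
            ((2 : ℝ) • (1 : Matrix (Fin ℓ) (Fin ℓ) ℝ) -
              ((n : ℝ) / s) • (∑ i ∈ Cs, vecMulVec (F i) (F i))).PosSemidef)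
          (Classical.decPred _)
          ((Finset.univ : Finset (Fin n)).powersetCard s)).card : ℝ) := by
  classical
  let S : Finset (Fin n) → Matrix (Fin ℓ) (Fin ℓ) ℝ := fun C => ∑ i ∈ C, vecMulVec (F i) (F i)
  refine le_trans (b := ((((Finset.univ : Finset (Fin n)).powersetCard s).filter fun C =>
        (((n : ℝ) / s) • S C - (1 / 2 : ℝ) • 1).PosSemidef ∧
          ((2 : ℝ) • 1 - ((n : ℝ) / s) • S C).PosSemidef).card : ℝ)) ?_ (le_of_eq (by congr!))
  have hn0 : 0 < n := hs0.trans_le hs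
  set N : ℝ := (((Finset.univ : Finset (Fin n)).powersetCard s).card : ℝ) with hN
  have hN0 : 0 ≤ N := Nat.cast_nonneg _
  rcases Nat.eq_zero_or_pos ℓ with rfl | hℓ
  · rw [Finset.filter_true_of_mem fun C _ => ?_, ← hN]
    · have : 0 ≤ (n : ℝ) ^ (-(10 : ℤ)) := by positivity
      nlinarith
    · have hzero : ∀ A : Matrix (Fin 0) (Fin 0) ℝ, A.PosSemidef := fun A => by
        rw [Subsingleton.elim A 0]
        exact PosSemidef.zero
      exact ⟨hzero _, hzero _⟩
  rcases Nat.lt_or_ge n 2 with hn1 | hn2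
  · obtain rfl : n = 1 := by omega
    simp
  have : Nonempty (Fin n) := ⟨⟨0, hn0⟩⟩
  have hnR : (2 : ℝ) ≤ n := by exact_mod_cast hn2
  have hs0R : (0 : ℝ) < s := by exact_mod_cast hs0
  have hiso : ∑ i, vecMulVec (F i) (F i) = 1 := by
    ext a b
    rw [Matrix.sum_apply, one_apply, ← horth a b, hF]
    rfl
  have hdot : ∀ i, F i ⬝ᵥ F i ≤ ρ := fun i => by simpa [dotProduct, pow_two] using hρ i
  have hℓρ : (ℓ : ℝ) ≤ n * ρ := by
    have h1 : (∑ i, vecMulVec (F i) (F i)).trace = ℓ := by simp [hiso]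
    rw [trace_sum] at h1
    simp only [trace_vecMulVec] at h1
    rw [← h1]
    exact (Finset.sum_le_sum fun i _ => hdot i).trans_eq (by simp)
  have hℓ1 : (1 : ℝ) ≤ ℓ := by exact_mod_cast hℓ
  have hρ0 : 0 < ρ := pos_of_mul_pos_right (by linarith) (Nat.cast_nonneg n)
  have hnρ : 0 < n * ρ := by positivity
  have hlog : 0.69 ≤ Real.log n :=
    (Real.log_two_gt_d9.le.trans' (by norm_num)).trans (Real.log_le_log two_pos hnR)
  have hℓn : (ℓ : ℝ) ≤ n := by
    have hsn : (s : ℝ) ≤ n := by exact_mod_cast hs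
    nlinarith
  set x : ℝ := s / (n * ρ) with hx
  have hxlog : 100 * Real.log n ≤ x := by
    rw [hx, le_div_iff₀ hnρ]
    linarith
  have hSherm : ∀ (c : ℝ) (C : Finset (Fin n)), (c • S C).IsHermitian := fun c C => by
    have hSC : (S C).IsHermitian := isHermitian_sum (fun i => by
      simpa using (posSemidef_vecMulVec_self_star (F i)).isHermitian) C
    rw [IsHermitian, conjTranspose_smul, star_trivial, hSC.eq]
  have hone : ∀ c : ℝ, (c • (1 : Matrix (Fin ℓ) (Fin ℓ) ℝ)).IsHermitian := fun c => by
    rw [IsHermitian, conjTranspose_smul, star_trivial, conjTranspose_one]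
  have hlow := card_filter_mul_exp_le hiso hρ0 hdot hs0 (-ρ⁻¹) (-(x / 2))
    (fun C => ¬ (((n : ℝ) / s) • S C - (1 / 2 : ℝ) • 1).PosSemidef) fun C hC => by
      obtain ⟨v, hv, hneg⟩ := ((hSherm _ C).sub (hone _)).exists_dotProduct_mulVec_neg hC
      refine ⟨v, hv, ?_⟩
      rw [sub_mulVec, smul_mulVec, smul_mulVec, one_mulVec, dotProduct_sub, dotProduct_smul,
        dotProduct_smul, hv, smul_eq_mul, smul_eq_mul, sub_neg, div_mul_eq_mul_div,
        div_lt_iff₀ hs0R] at hneg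
      rw [neg_mul, neg_le_neg_iff, hx, inv_mul_le_iff₀ hρ0,
        show ρ * (s / (n * ρ) / 2) = s / 2 / n by field_simp, le_div_iff₀ (by positivity)]
      linarith
  have hup := card_filter_mul_exp_le hiso hρ0 hdot hs0 ρ⁻¹ (2 * x)
    (fun C => ¬ ((2 : ℝ) • 1 - ((n : ℝ) / s) • S C).PosSemidef) fun C hC => by
      obtain ⟨v, hv, hneg⟩ := ((hone _).sub (hSherm _ C)).exists_dotProduct_mulVec_neg hC
      refine ⟨v, hv, ?_⟩
      rw [sub_mulVec, smul_mulVec, smul_mulVec, one_mulVec, dotProduct_sub, dotProduct_smul,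
        dotProduct_smul, hv, smul_eq_mul, smul_eq_mul, sub_neg, div_mul_eq_mul_div,
        lt_div_iff₀ hs0R] at hneg
      rw [hx, le_inv_mul_iff₀ hρ0,
        show ρ * (2 * (s / (n * ρ))) = 2 * s / n by field_simp, div_le_iff₀ (by positivity)]
      linarith
  rw [neg_mul, inv_mul_cancel₀ hρ0.ne', Fintype.card_fin, Fintype.card_fin, ← hN,
    ← le_div_iff₀ (Real.exp_pos _), mul_div_assoc, mul_div_assoc, ← Real.exp_sub,
    show s * ((Real.exp (-1) - 1) / (n * ρ)) - -(x / 2) = x * (Real.exp (-1) - 1 / 2) by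
      rw [hx]; ring] at hlow
  rw [inv_mul_cancel₀ hρ0.ne', Fintype.card_fin, Fintype.card_fin, ← hN,
    ← le_div_iff₀ (Real.exp_pos _), mul_div_assoc, mul_div_assoc, ← Real.exp_sub,
    show s * ((Real.exp 1 - 1) / (n * ρ)) - 2 * x = x * (Real.exp 1 - 3) by
      rw [hx]; ring] at hup
  have htail : ∀ a : ℝ, a ≤ -(12 / 100) →
      N * (ℓ * Real.exp (x * a)) ≤ N * ((n : ℝ) ^ (-(10 : ℤ)) / 2) := fun a ha => by
    refine mul_le_mul_of_nonneg_left ?_ hN0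
    have hpow : (n : ℝ) ^ (-(10 : ℤ)) = n * n * (n : ℝ) ^ (-(12 : ℤ)) := by
      rw [← pow_two, ← zpow_natCast, ← zpow_add₀ (by positivity)]
      norm_num
    calc (ℓ : ℝ) * Real.exp (x * a) ≤ n * (n : ℝ) ^ (-(12 : ℤ)) :=
          mul_le_mul hℓn (exp_mul_le_pow_neg_twelve hn0 ha hxlog) (Real.exp_pos _).le (by positivity)
      _ ≤ (n : ℝ) ^ (-(10 : ℤ)) / 2 := by
          rw [hpow, le_div_iff₀ two_pos]
          have : 0 ≤ n * (n : ℝ) ^ (-(12 : ℤ)) := by positivity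
          nlinarith
  have hlow' := hlow.trans (htail _ (by linarith [Real.exp_neg_one_lt_d9]))
  have hup' := hup.trans (htail _ (by linarith [Real.exp_one_lt_d9]))
  have hsplit : N ≤ ((((Finset.univ : Finset (Fin n)).powersetCard s).filter fun C =>
        (((n : ℝ) / s) • S C - (1 / 2 : ℝ) • 1).PosSemidef ∧
          ((2 : ℝ) • 1 - ((n : ℝ) / s) • S C).PosSemidef).card
      + (((Finset.univ : Finset (Fin n)).powersetCard s).filter fun C =>
        ¬ (((n : ℝ) / s) • S C - (1 / 2 : ℝ) • 1).PosSemidef).card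
      + (((Finset.univ : Finset (Fin n)).powersetCard s).filter fun C =>
        ¬ ((2 : ℝ) • 1 - ((n : ℝ) / s) • S C).PosSemidef).card : ℝ) := by
    rw [hN]
    exact_mod_cast Finset.card_le_card_filter_and_add_card_filter_not _ _ _
  linarith
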